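/- Let n ≥ 2, let G be a strongly connected directed simple graph on V = Fin n with m edges and distinguished vertex 0. Then there exists A ∈ Θ_G at which the rank of the differential of the double characteristic polynomial map c restricted to Θ_G equals m + 1, if and only if there exists A ∈ Θ_G such that the only matrix X : Matrix (Fin n) (Fin n) ℂ satisfying X 0 j = 0, X j 0 = 0 and X j j = 0 for all j : Fin n, and X * A − A * X ∈ Θ_G, is X = 0. -/

import Mathlib

open Matrix Polynomial

attribute [local instance] Classical.propDecidable
attribute [local instance] Matrix.normedAddCommGroup Matrix.normedSpace

variable {V : Type*}

/-- The parameter space `Θ_G` of a directed simple graph given by the edge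
relation `E` (where `E j i` means there is an edge `j → i`): matrices whose
off-diagonal entry `(i,j)` vanishes unless `j → i` is an edge. -/
def Theta (E : V → V → Prop) : Set (Matrix V V ℂ) :=
  {A | ∀ i j, i ≠ j → ¬ E j i → A i j = 0}

/-- `Θ_G` as a `ℂ`-linear subspace of the matrix space. -/
noncomputable def ThetaSub (E : V → V → Prop) : Submodule ℂ (Matrix V V ℂ) where
  carrier := Theta E
  add_mem' := by
    intro a b ha hb i j h1 h2
    simp only [Matrix.add_apply, ha i j h1 h2, hb i j h1 h2, add_zero]
  zero_mem' := by intro i j _ _; rfl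
  smul_mem' := by
    intro c A hA i j h1 h2
    simp only [Matrix.smul_apply, hA i j h1 h2, smul_zero]

/-- The coefficient matrix `B_G(A)`: rows indexed by the non-edges
`(k,l)` (the zero positions of a generic element of `Θ_G`), columns indexed
by pairs `(i,j)` with `i ≠ j` avoiding the distinguished vertex `r`. -/
noncomputable def Bmat (E : V → V → Prop) (r : V) (A : Matrix V V ℂ) :
    Matrix {p : V × V // p.1 ≠ p.2 ∧ ¬ E p.2 p.1}
      {p : V × V // p.1 ≠ p.2 ∧ p.1 ≠ r ∧ p.2 ≠ r} ℂ :=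
  fun kl ij =>
    if ij.1.1 = kl.1.1 ∧ ij.1.2 = kl.1.2 then A kl.1.1 kl.1.1 - A kl.1.2 kl.1.2
    else if ij.1.1 = kl.1.1 then -A ij.1.2 kl.1.2
    else if ij.1.2 = kl.1.2 then A kl.1.1 ij.1.1
    else 0

/-- The embedding `Fin (n-1) → Fin n` skipping `0` (deleting row/column `0`). -/
def finEmb (n : ℕ) (i : Fin (n - 1)) : Fin n :=
  ⟨i.1 + 1, by have := i.isLt; omega⟩

/-- The double characteristic polynomial map: the coefficients of the
characteristic polynomials of `A` and of `A₁` (with row `0` and column `0`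
deleted); its codomain is `(2n-1)`-dimensional. -/
noncomputable def dcp (n : ℕ) (A : Matrix (Fin n) (Fin n) ℂ) :
    (Fin n → ℂ) × (Fin (n - 1) → ℂ) :=
  (fun k => A.charpoly.coeff k,
   fun k => (A.submatrix (finEmb n) (finEmb n)).charpoly.coeff k)

/-- The rank of the differential of the double characteristic polynomial map
at `A`, restricted to the subspace `Θ_G`. -/
noncomputable def diffRank (n : ℕ) (E : Fin n → Fin n → Prop)
    (A : Matrix (Fin n) (Fin n) ℂ) : ℕ :=
  Module.finrank ℂ
    (LinearMap.range ((fderiv ℂ (dcp n) A).toLinearMap ∘ₗ (ThetaSub E).subtype))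

section CharpolyOfMinor

variable {R ι : Type*} [CommRing R] [Fintype ι] [DecidableEq ι]

theorem coeff_matPolyEquiv_adjugate_charmatrix (A : Matrix ι ι R) (j : ℕ) :
    (matPolyEquiv (adjugate (charmatrix A))).coeff j =
      A.charpoly.coeff (j + 1) • (1 : Matrix ι ι R) +
        (matPolyEquiv (adjugate (charmatrix A))).coeff (j + 1) * A := by
  have h : matPolyEquiv (adjugate (charmatrix A)) * (X - C A) =
      matPolyEquiv (A.charpoly • (1 : Matrix ι ι R[X])) := by
    rw [← matPolyEquiv_charmatrix, ← map_mul, adjugate_mul, Matrix.charpoly]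
  have h' := congrArg (fun p => p.coeff (j + 1)) h
  simp only [mul_sub, coeff_sub, coeff_mul_X, coeff_mul_C, matPolyEquiv_smul_one,
    Polynomial.coeff_map] at h'
  rw [sub_eq_iff_eq_add] at h'
  rw [h', Algebra.algebraMap_eq_smul_one]

theorem coeff_matPolyEquiv_adjugate_charmatrix_eq_sum_add (A : Matrix ι ι R) (j N : ℕ) :
    (matPolyEquiv (adjugate (charmatrix A))).coeff j =
      ∑ i ∈ Finset.range N, A.charpoly.coeff (j + 1 + i) • A ^ i +
        (matPolyEquiv (adjugate (charmatrix A))).coeff (j + N) * A ^ N := by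
  induction N with
  | zero => simp
  | succ N ih =>
    rw [ih, Finset.sum_range_succ, coeff_matPolyEquiv_adjugate_charmatrix A (j + N), add_mul,
      smul_mul_assoc, one_mul, mul_assoc, ← pow_succ', add_right_comm j N 1]
    abel_nf

theorem coeff_matPolyEquiv_adjugate_charmatrix_eq_sum (A : Matrix ι ι R) (j : ℕ) :
    (matPolyEquiv (adjugate (charmatrix A))).coeff j =
      ∑ i ∈ Finset.range (Fintype.card ι), A.charpoly.coeff (j + 1 + i) • A ^ i := by
  nontriviality R
  rw [coeff_matPolyEquiv_adjugate_charmatrix_eq_sum_add A j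
    (Fintype.card ι + ((matPolyEquiv (adjugate (charmatrix A))).natDegree + 1)),
    coeff_eq_zero_of_natDegree_lt (by omega), zero_mul, add_zero]
  symm
  apply Finset.sum_subset (by intro x; simp; omega)
  intro i _ hi
  rw [coeff_eq_zero_of_natDegree_lt, zero_smul]
  rw [charpoly_natDegree_eq_dim]
  simp at hi
  omega

end CharpolyOfMinor

theorem coeff_charpoly_submatrix_succ {R : Type*} [CommRing R] {n : ℕ}
    (A : Matrix (Fin (n + 1)) (Fin (n + 1)) R) (j : ℕ) :
    (A.submatrix Fin.succ Fin.succ).charpoly.coeff j =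
      ∑ i ∈ Finset.range (n + 1), A.charpoly.coeff (j + 1 + i) * (A ^ i) 0 0 := by
  have h := congrFun (congrFun (coeff_matPolyEquiv_adjugate_charmatrix_eq_sum A j) 0) 0
  rw [matPolyEquiv_coeff_apply] at h
  have hadj : adjugate (charmatrix A) 0 0 = (A.submatrix Fin.succ Fin.succ).charpoly := by
    have h1 := adjugate_fin_succ_eq_det_submatrix (charmatrix A) 0 0
    simp only [Fin.val_zero, add_zero, pow_zero, one_mul, Fin.succAbove_zero] at h1
    rw [Matrix.charpoly]
    convert h1 using 2
    ext a b : 2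
    by_cases hab : a = b
    · simp [hab]
    · simp [charmatrix_apply_ne, hab]
  rw [← hadj, h, Matrix.sum_apply]
  simp

/-- The Krylov matrix of `A` at the vertex `0`: its `k`-th column is `A ^ k` applied to the
`0`-th standard basis vector. -/
def krylov {R : Type*} [CommRing R] {n : ℕ} (A : Matrix (Fin (n + 1)) (Fin (n + 1)) R) :
    Matrix (Fin (n + 1)) (Fin (n + 1)) R :=
  Matrix.of fun i k => (A ^ (k : ℕ)) i 0

theorem krylov_map {R S : Type*} [CommRing R] [CommRing S] {n : ℕ} (f : R →+* S)
    (A : Matrix (Fin (n + 1)) (Fin (n + 1)) R) : krylov (A.map f) = (krylov A).map f := by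
  ext i k
  simp [krylov, ← Matrix.map_pow]

section ParentFunction

variable {α : Type*}

theorem exists_parent_of_reflTransGen (E : α → α → Prop) (r : α)
    (h : ∀ v, Relation.ReflTransGen E r v) :
    ∃ (π : α → α) (δ : α → ℕ), ∀ v, v ≠ r → E (π v) v ∧ δ v = δ (π v) + 1 := by
  let Reach : ℕ → α → Prop := fun k =>
    Nat.rec (motive := fun _ => α → Prop) (fun v => v = r) (fun _ S v => ∃ u, S u ∧ E u v) k
  have hex : ∀ v : α, ∃ k : ℕ, Reach k v := by
    intro v
    induction h v with
    | refl => exact ⟨0, rfl⟩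
    | @tail b c _ hbc ih =>
      obtain ⟨k, hk⟩ := ih
      exact ⟨k + 1, b, hk, hbc⟩
  have hmin : ∀ v : α, ∃ d : ℕ, Reach d v ∧ ∀ k, Reach k v → d ≤ k := by
    classical
    exact fun v => ⟨Nat.find (hex v), Nat.find_spec (hex v), fun k => Nat.find_min' (hex v)⟩
  choose δ hδ hδ_le using hmin
  have hpar : ∀ v : α, ∃ u : α, v ≠ r → E u v ∧ δ v = δ u + 1 := by
    intro v
    by_cases hv : v = r
    · exact ⟨v, fun h => absurd hv h⟩
    have hs := hδ v
    obtain ⟨k, hk⟩ : ∃ k, δ v = k + 1 := by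
      refine Nat.exists_eq_succ_of_ne_zero fun h0 => hv ?_
      rw [h0] at hs
      exact hs
    rw [hk] at hs
    obtain ⟨u, hu, huv⟩ := hs
    refine ⟨u, fun _ => ⟨huv, le_antisymm (hδ_le v _ ⟨u, hδ u, huv⟩) ?_⟩⟩
    rw [hk]
    exact Nat.succ_le_succ (hδ_le u k hu)
  choose π hπ using hpar
  exact ⟨π, δ, hπ⟩

/-- The matrix of a rooted tree, with the values of `d` on the diagonal and a one for each edge
from a parent to its child. -/
noncomputable def treeMatrix [DecidableEq α] (r : α) (π : α → α) (d : α → ℂ) : Matrix α α ℂ :=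
  Matrix.of fun v u => (if v = u then d v else 0) + if v ≠ r ∧ π v = u then 1 else 0

theorem eq_zero_of_vecMul_treeMatrix [Fintype α] [DecidableEq α] (r : α) (π : α → α) (d : α → ℂ)
    (hd : Function.Injective d) (δ : α → ℕ) (hδ : ∀ v, v ≠ r → δ v = δ (π v) + 1)
    (w : α → ℂ) (c : ℂ) (hw : w ᵥ* treeMatrix r π d = c • w) (hr : w r = 0) : w = 0 := by
  have heq : ∀ u, w u * d u + ∑ v, (if v ≠ r ∧ π v = u then w v else 0) = c * w u := by
    intro u
    have := congrFun hw u
    simpa [vecMul, dotProduct, treeMatrix, mul_add, Finset.sum_add_distrib] using this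
  by_contra hne
  obtain ⟨v₀, hv₀⟩ := Function.ne_iff.mp hne
  obtain ⟨x, hx, hmax⟩ := Finset.exists_max_image (Finset.univ.filter fun v => w v ≠ 0) δ
    ⟨v₀, by simpa using hv₀⟩
  obtain ⟨y, hy, hmin⟩ := Finset.exists_min_image (Finset.univ.filter fun v => w v ≠ 0) δ
    ⟨v₀, by simpa using hv₀⟩
  simp only [Finset.mem_filter, Finset.mem_univ, true_and] at hx hmax hy hmin
  have hroot : ∀ v, w v ≠ 0 → v ≠ r := fun v hv h => hv (h ▸ hr)
  have hcx : c = d x := by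
    have h := heq x
    rw [Finset.sum_eq_zero, add_zero, mul_comm] at h
    · exact (mul_right_cancel₀ hx h).symm
    · intro v _
      split_ifs with hv
      · by_contra hv'
        have := hmax v hv'
        have := hδ v hv.1
        rw [hv.2] at this
        omega
      · rfl
  have hanc : ∀ k v, w v ≠ 0 → δ x - δ v = k → v = π^[k] x := by
    intro k
    induction k with
    | zero =>
      intro v hv hk
      by_contra hvx
      have h := heq v
      have hsum : ∑ u, (if u ≠ r ∧ π u = v then w u else 0) = 0 := by
        refine Finset.sum_eq_zero fun u _ => ?_
        split_ifs with hu
        · by_contra hu'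
          have := hmax u hu'
          have := hδ u hu.1
          rw [hu.2] at this
          omega
        · rfl
      rw [hsum, add_zero, mul_comm] at h
      exact hvx (hd ((mul_right_cancel₀ hv h).trans hcx))
    | succ k ih =>
      intro v hv hk
      have hvx : v ≠ x := by
        rintro rfl
        omega
      have hsum : ∑ u, (if u ≠ r ∧ π u = v then w u else 0) ≠ 0 := by
        intro h0
        have h := heq v
        rw [h0, add_zero, mul_comm] at h
        exact hvx (hd ((mul_right_cancel₀ hv h).trans hcx))
      obtain ⟨u, -, hu⟩ := Finset.exists_ne_zero_of_sum_ne_zero hsum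
      split_ifs at hu with hu'
      · have hux := hδ u hu'.1
        rw [hu'.2] at hux
        rw [Function.iterate_succ_apply', ← ih u hu (by omega), hu'.2]
      · exact absurd rfl hu
  have hyr := hroot y hy
  have h := heq (π y)
  have hπy : w (π y) = 0 := by
    by_contra h0
    have := hmin _ h0
    have := hδ y hyr
    omega
  rw [hπy, zero_mul, mul_zero, zero_add, Finset.sum_eq_single y] at h
  · rw [if_pos ⟨hyr, rfl⟩] at h
    exact hy h
  · intro v _ hvy
    split_ifs with hv
    · by_contra hv'
      apply hvy
      rw [hanc _ v hv' rfl, hanc _ y hy rfl, hδ v hv.1, hδ y hyr, hv.2]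
    · rfl
  · simp

end ParentFunction

theorem vecMul_pow_apply_zero_of_vecMul_krylov_eq_zero {R : Type*} [Field R] {n : ℕ}
    (A : Matrix (Fin (n + 1)) (Fin (n + 1)) R) (w : Fin (n + 1) → R) (hw : w ᵥ* krylov A = 0)
    (k : ℕ) : (w ᵥ* A ^ k) 0 = 0 := by
  have hlin : ∀ p : R[X], p.natDegree < n + 1 → (w ᵥ* aeval A p) 0 = 0 := by
    intro p hp
    rw [aeval_eq_sum_range' hp, Matrix.vecMul_sum, Finset.sum_apply]
    refine Finset.sum_eq_zero fun i hi => ?_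
    have := congrFun hw ⟨i, Finset.mem_range.mp hi⟩
    rw [Matrix.vecMul_smul, Pi.smul_apply]
    simp only [vecMul, dotProduct, krylov, Matrix.of_apply, Pi.zero_apply] at this ⊢
    rw [this, smul_zero]
  have hmod : aeval A (X ^ k %ₘ A.charpoly) = A ^ k := by
    have := congrArg (aeval A) (modByMonic_add_div (X ^ k : R[X]) A.charpoly)
    simpa [Matrix.aeval_self_charpoly] using this
  rw [← hmod]
  apply hlin
  have hdeg := natDegree_modByMonic_lt (X ^ k : R[X]) (Matrix.charpoly_monic A)
    (fun h => by simpa [h] using charpoly_natDegree_eq_dim A)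
  simpa using hdeg

theorem det_krylov_ne_zero_of_left_eigenvector {n : ℕ} (A : Matrix (Fin (n + 1)) (Fin (n + 1)) ℂ)
    (h : ∀ (w : Fin (n + 1) → ℂ) (c : ℂ), w ᵥ* A = c • w → w 0 = 0 → w = 0) :
    (krylov A).det ≠ 0 := by
  intro hdet
  obtain ⟨w, hw, hw0⟩ := Matrix.exists_vecMul_eq_zero_iff.mpr hdet
  let W : Submodule ℂ (Fin (n + 1) → ℂ) :=
    { carrier := {w | ∀ k : ℕ, (w ᵥ* A ^ k) 0 = 0}
      add_mem' := fun ha hb k => by simp [Matrix.add_vecMul, ha k, hb k]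
      zero_mem' := fun k => by simp
      smul_mem' := fun c a ha k => by simp [Matrix.smul_vecMul, ha k] }
  have hinv : ∀ w ∈ W, A.vecMulLinear w ∈ W := by
    intro w hw k
    rw [Matrix.vecMulLinear_apply, Matrix.vecMul_vecMul, ← pow_succ']
    exact hw (k + 1)
  have hwW : w ∈ W := vecMul_pow_apply_zero_of_vecMul_krylov_eq_zero A w hw0
  have : Nontrivial W := ⟨⟨⟨w, hwW⟩, 0, fun h => hw (congrArg Subtype.val h)⟩⟩
  obtain ⟨c, hc⟩ := Module.End.exists_eigenvalue (A.vecMulLinear.restrict hinv)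
  obtain ⟨v, hv⟩ := hc.exists_hasEigenvector
  refine hv.2 (Subtype.ext (h v.1 c ?_ ?_))
  · exact congrArg Subtype.val hv.apply_eq_smul
  · simpa using v.2 0

theorem exists_mem_Theta_det_krylov_ne_zero {n : ℕ} (E : Fin (n + 1) → Fin (n + 1) → Prop)
    (hsc : ∀ v, Relation.ReflTransGen E 0 v) : ∃ A ∈ Theta E, (krylov A).det ≠ 0 := by
  obtain ⟨π, δ, hδ⟩ := exists_parent_of_reflTransGen E 0 hsc
  refine ⟨treeMatrix 0 π fun v => ((v : ℕ) : ℂ), ?_, ?_⟩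
  · intro i j hij hE
    have : ¬ (i ≠ 0 ∧ π i = j) := by
      rintro ⟨hi, rfl⟩
      exact hE (hδ i hi).1
    simp only [treeMatrix, Matrix.of_apply, if_neg hij, if_neg this, add_zero]
  · exact det_krylov_ne_zero_of_left_eigenvector _ fun w c hw h0 =>
      eq_zero_of_vecMul_treeMatrix 0 π _ (fun a b hab => Fin.ext (by exact_mod_cast hab)) δ
        (fun v hv => (hδ v hv).2) w c hw h0

theorem contDiff_coeff_charpoly {ι : Type*} [Fintype ι] [DecidableEq ι] (k : ℕ) :
    ContDiff ℂ 1 fun A : Matrix ι ι ℂ => A.charpoly.coeff k := by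
  have h := (AnalyticOnNhd.eval_linearMap
    (LinearMap.pi fun p : ι × ι => Matrix.entryLinearMap ℂ ℂ p.1 p.2)
    ((charpoly.univ ℂ ι).coeff k)).contDiff (n := 1)
  have heq : (fun A : Matrix ι ι ℂ => A.charpoly.coeff k) = _ := funext fun A =>
    (charpoly.univ_coeff_eval₂Hom ι (RingHom.id ℂ) (fun p => A p.1 p.2) k).symm
  rw [heq]
  exact h

theorem contDiff_dcp (n : ℕ) : ContDiff ℂ 1 (dcp n) := by
  refine ContDiff.prodMk (contDiff_pi.mpr fun k => contDiff_coeff_charpoly k)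
    (contDiff_pi.mpr fun k => ?_)
  exact (contDiff_coeff_charpoly (k : ℕ)).comp
    (LinearMap.toContinuousLinearMap
      ({ toFun := fun A => A.submatrix (finEmb n) (finEmb n)
         map_add' := fun _ _ => rfl
         map_smul' := fun _ _ => rfl } :
        Matrix (Fin n) (Fin n) ℂ →ₗ[ℂ] Matrix (Fin (n - 1)) (Fin (n - 1)) ℂ)).contDiff

theorem coeff_charpoly_card {n : ℕ} (A : Matrix (Fin n) (Fin n) ℂ) : A.charpoly.coeff n = 1 := by
  simpa [Monic, leadingCoeff] using A.charpoly_monic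

theorem sum_coeff_charpoly_smul_pow {n : ℕ} (A : Matrix (Fin n) (Fin n) ℂ) :
    ∑ k ∈ Finset.range (n + 1), A.charpoly.coeff k • A ^ k = 0 := by
  rw [← aeval_eq_sum_range' (by simp), A.aeval_self_charpoly]

section KernelOfDifferential

variable {n : ℕ} (A M : Matrix (Fin (n + 1)) (Fin (n + 1)) ℂ)

/-- The derivative at `t = 0` of the vector `(A + t M) ^ k e₀`. -/
def krylovDeriv : ℕ → Fin (n + 1) → ℂ
  | 0 => 0
  | k + 1 => A *ᵥ krylovDeriv k + M *ᵥ fun j => (A ^ k) j 0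

theorem hasDerivAt_add_smul_apply (i j : Fin (n + 1)) :
    HasDerivAt (fun t : ℂ => (A + t • M) i j) (M i j) 0 := by
  simpa using ((hasDerivAt_id (0 : ℂ)).mul_const (M i j)).const_add (A i j)

theorem hasDerivAt_pow_apply_zero (k : ℕ) (i : Fin (n + 1)) :
    HasDerivAt (fun t : ℂ => ((A + t • M) ^ k) i 0) (krylovDeriv A M k i) 0 := by
  induction k generalizing i with
  | zero => simpa [krylovDeriv] using hasDerivAt_const (0 : ℂ) ((1 : Matrix _ _ ℂ) i 0)
  | succ k ih =>
    simp only [pow_succ', Matrix.mul_apply]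
    refine (HasDerivAt.fun_sum (u := Finset.univ)
      fun j _ => (hasDerivAt_add_smul_apply A M i j).fun_mul (ih j)).congr_deriv ?_
    simp [krylovDeriv, mulVec, dotProduct, Finset.sum_add_distrib, add_comm]

variable {A M}

theorem hasDerivAt_dcp (hM : fderiv ℂ (dcp (n + 1)) A M = 0) :
    HasDerivAt (fun t : ℂ => dcp (n + 1) (A + t • M)) 0 0 := by
  have hA : HasFDerivAt (dcp (n + 1)) (fderiv ℂ (dcp (n + 1)) A) A :=
    ((contDiff_dcp (n + 1)).differentiable one_ne_zero A).hasFDerivAt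
  have hline : HasDerivAt (fun t : ℂ => A + t • M) M 0 := by
    have h := ((hasDerivAt_id' (0 : ℂ)).smul_const M).const_add A
    rw [one_smul] at h
    exact h
  rw [← hM]
  exact hA.comp_hasDerivAt_of_eq 0 hline (by simp)

theorem hasDerivAt_coeff_charpoly (hM : fderiv ℂ (dcp (n + 1)) A M = 0) (k : ℕ) :
    HasDerivAt (fun t : ℂ => (A + t • M).charpoly.coeff k) 0 0 := by
  rcases lt_or_ge k (n + 1) with hk | hk
  · exact hasDerivAt_pi.mp ((ContinuousLinearMap.fst ℂ (Fin (n + 1) → ℂ)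
      (Fin (n + 1 - 1) → ℂ)).hasFDerivAt.comp_hasDerivAt 0 (hasDerivAt_dcp hM)) ⟨k, hk⟩
  · have hconst : ∀ B : Matrix (Fin (n + 1)) (Fin (n + 1)) ℂ,
        B.charpoly.coeff k = if k = n + 1 then 1 else 0 := by
      intro B
      have hdeg : B.charpoly.natDegree = n + 1 := by simp
      split_ifs with h
      · rw [h, coeff_charpoly_card]
      · exact coeff_eq_zero_of_natDegree_lt (by omega)
    simp only [hconst]
    exact hasDerivAt_const _ _

theorem krylovDeriv_apply_zero (hM : fderiv ℂ (dcp (n + 1)) A M = 0) (k : ℕ) (hk : k < n + 1) :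
    krylovDeriv A M k 0 = 0 := by
  induction k using Nat.strong_induction_on with
  | _ k ih =>
  rcases Nat.eq_zero_or_pos k with rfl | hpos
  · rfl
  have hq : HasDerivAt (fun t : ℂ =>
      ((A + t • M).submatrix Fin.succ Fin.succ).charpoly.coeff (n - k)) 0 0 :=
    hasDerivAt_pi.mp ((ContinuousLinearMap.snd ℂ (Fin (n + 1) → ℂ)
      (Fin (n + 1 - 1) → ℂ)).hasFDerivAt.comp_hasDerivAt 0 (hasDerivAt_dcp hM))
      (⟨n - k, by omega⟩ : Fin n)
  simp only [coeff_charpoly_submatrix_succ] at hq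
  have hsum := HasDerivAt.fun_sum (u := Finset.range (n + 1)) fun i _ =>
    (hasDerivAt_coeff_charpoly hM (n - k + 1 + i)).fun_mul (hasDerivAt_pow_apply_zero A M i 0)
  have h := hsum.unique hq
  have hdeg : A.charpoly.natDegree = n + 1 := by simp
  rw [Finset.sum_eq_single k] at h
  · rw [show n - k + 1 + k = n + 1 by omega, coeff_charpoly_card] at h
    simpa using h
  · intro i hi hik
    rcases lt_or_gt_of_ne hik with hlt | hgt
    · simp [ih i hlt (by omega)]
    · simp only [zero_smul, add_zero, zero_mul, zero_add]
      rw [coeff_eq_zero_of_natDegree_lt (by omega), zero_mul]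
  · simp [hk]

theorem sum_coeff_mul_krylovDeriv (hM : fderiv ℂ (dcp (n + 1)) A M = 0) (i : Fin (n + 1)) :
    ∑ k ∈ Finset.range (n + 2), A.charpoly.coeff k * krylovDeriv A M k i = 0 := by
  have hCH : ∀ B : Matrix (Fin (n + 1)) (Fin (n + 1)) ℂ,
      ∑ k ∈ Finset.range (n + 2), B.charpoly.coeff k * (B ^ k) i 0 = 0 := by
    intro B
    simpa [Matrix.sum_apply] using congrFun (congrFun (sum_coeff_charpoly_smul_pow B) i) 0
  have hsum := HasDerivAt.fun_sum (u := Finset.range (n + 2)) fun k _ =>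
    (hasDerivAt_coeff_charpoly hM k).fun_mul (hasDerivAt_pow_apply_zero A M k i)
  simp only [hCH] at hsum
  have h := hsum.unique (hasDerivAt_const _ _)
  simpa using h

theorem exists_commutator_of_fderiv_dcp_eq_zero (hA : (krylov A).det ≠ 0)
    (hM : fderiv ℂ (dcp (n + 1)) A M = 0) :
    ∃ X : Matrix (Fin (n + 1)) (Fin (n + 1)) ℂ,
      (∀ j, X 0 j = 0) ∧ (∀ j, X j 0 = 0) ∧ X * A - A * X = M := by
  have hunit : IsUnit (krylov A).det := isUnit_iff_ne_zero.mpr hA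
  have hcancel : ∀ B C : Matrix (Fin (n + 1)) (Fin (n + 1)) ℂ,
      B * krylov A = C * krylov A → B = C := fun B C h => by
    rw [← Matrix.mul_nonsing_inv_cancel_right _ B hunit, h,
      Matrix.mul_nonsing_inv_cancel_right _ C hunit]
  set X : Matrix (Fin (n + 1)) (Fin (n + 1)) ℂ :=
    Matrix.of (fun i (k : Fin (n + 1)) => krylovDeriv A M k i) * (krylov A)⁻¹ with hX
  have hXK : X * krylov A = Matrix.of (fun i (k : Fin (n + 1)) => krylovDeriv A M k i) := by
    rw [hX, Matrix.mul_assoc, Matrix.nonsing_inv_mul _ hunit, Matrix.mul_one]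
  have hlt : ∀ k < n + 1, ∀ i, (X * A ^ k) i 0 = krylovDeriv A M k i := by
    intro k hk i
    exact congrFun (congrFun hXK i) ⟨k, hk⟩
  have htop : ∀ i, (X * A ^ (n + 1)) i 0 = krylovDeriv A M (n + 1) i := by
    intro i
    have h : ∑ k ∈ Finset.range (n + 2), A.charpoly.coeff k * (X * A ^ k) i 0 = 0 := by
      have h : X * ∑ k ∈ Finset.range (n + 2), A.charpoly.coeff k • A ^ k = 0 := by
        rw [sum_coeff_charpoly_smul_pow A, Matrix.mul_zero]
      rw [Matrix.mul_sum] at h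
      simpa only [Matrix.sum_apply, Matrix.mul_smul, Matrix.smul_apply, smul_eq_mul,
        Matrix.zero_apply] using
        congrFun (congrFun h i) 0
    have h' := sum_coeff_mul_krylovDeriv hM i
    rw [Finset.sum_range_succ, coeff_charpoly_card, one_mul] at h h'
    rw [Finset.sum_congr rfl fun k hk => by rw [hlt k (Finset.mem_range.mp hk) i]] at h
    exact add_left_cancel (h.trans h'.symm)
  have hle : ∀ k ≤ n + 1, ∀ i, (X * A ^ k) i 0 = krylovDeriv A M k i := by
    intro k hk
    rcases hk.lt_or_eq with h | rfl
    · exact hlt k h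
    · exact htop
  refine ⟨X, ?_, fun j => ?_, hcancel _ _ ?_⟩
  · have hrow : X 0 ᵥ* krylov A = 0 := by
      ext k
      have h := congrFun (congrFun hXK 0) k
      rw [Matrix.of_apply, krylovDeriv_apply_zero hM k k.2] at h
      exact h
    have h0 := Matrix.eq_zero_of_vecMul_eq_zero hA hrow
    exact congrFun h0
  · simpa [krylovDeriv] using hlt 0 (by omega) j
  · ext i k
    have h1 := hle (k + 1) (by omega) i
    have h2 := fun j => hle k (by omega) j
    have e1 : ((X * A - A * X) * krylov A) i k =
        (X * A ^ ((k : ℕ) + 1)) i 0 - (A * (X * A ^ (k : ℕ))) i 0 := by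
      change ((X * A - A * X) * A ^ (k : ℕ)) i 0 = _
      rw [Matrix.sub_mul, pow_succ', Matrix.mul_assoc X, Matrix.mul_assoc A, Matrix.sub_apply]
    rw [e1, h1, Matrix.mul_apply]
    simp only [h2]
    simp [krylovDeriv, Matrix.mul_apply, mulVec, dotProduct, krylov]

end KernelOfDifferential

section DimensionCount

/-- The matrices whose entries vanish outside the index set `S`. -/
def supportedOn {ι : Type*} (S : Set (ι × ι)) : Submodule ℂ (Matrix ι ι ℂ) where
  carrier := {A | ∀ i j, (i, j) ∉ S → A i j = 0}
  add_mem' ha hb i j h := by simp [ha i j h, hb i j h]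
  zero_mem' i j _ := rfl
  smul_mem' c a ha i j h := by simp [ha i j h]

theorem finrank_supportedOn {ι : Type*} [Finite ι] (S : Set (ι × ι)) :
    Module.finrank ℂ (supportedOn S) = S.ncard := by
  classical
  have := Fintype.ofFinite ι
  let e : supportedOn S ≃ₗ[ℂ] (S → ℂ) :=
    { toFun := fun A s => A.1 s.1.1 s.1.2
      map_add' := fun _ _ => rfl
      map_smul' := fun _ _ => rfl
      invFun := fun f => ⟨Matrix.of fun i j => if h : (i, j) ∈ S then f ⟨(i, j), h⟩ else 0,
        fun i j h => by simp [h]⟩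
      left_inv := fun A => by
        ext i j
        by_cases h : (i, j) ∈ S
        · simp [h]
        · simp [h, A.2 i j h]
      right_inv := fun f => by
        ext s
        simp }
  rw [e.finrank_eq, Module.finrank_fintype_fun_eq_card, ← Nat.card_eq_fintype_card,
    Nat.card_coe_set_eq]

theorem finrank_ThetaSub {n : ℕ} (E : Fin n → Fin n → Prop) (hirr : ∀ v, ¬ E v v) :
    Module.finrank ℂ (ThetaSub E) = n + Nat.card {p : Fin n × Fin n // E p.1 p.2} := by
  have h : ThetaSub E = supportedOn (Set.diagonal (Fin n) ∪ Prod.swap '' {p | E p.1 p.2}) := by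
    ext A
    refine forall₂_congr fun i j => ?_
    simp [not_or]
  rw [h, finrank_supportedOn, Set.ncard_union_eq]
  · congr 1
    · rw [← Set.range_diag, ← Set.image_univ,
        Set.ncard_image_of_injective _ fun a b h => congrArg Prod.fst h, Set.ncard_univ,
        Nat.card_fin]
    · rw [Set.ncard_image_of_injective _ Prod.swap_injective]
      exact (Nat.card_coe_set_eq _).symm
  · rw [Set.disjoint_left]
    rintro ⟨i, j⟩ hij
    obtain rfl : i = j := hij
    simpa using hirr i

/-- The commutator `X ↦ X A - A X` as a linear map. -/
noncomputable def commutatorRight {ι : Type*} [Fintype ι] (A : Matrix ι ι ℂ) :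
    Matrix ι ι ℂ →ₗ[ℂ] Matrix ι ι ℂ where
  toFun X := X * A - A * X
  map_add' X Y := by rw [Matrix.add_mul, Matrix.mul_add]; abel
  map_smul' c X := by simp [smul_sub]

variable {n : ℕ} {A : Matrix (Fin (n + 1)) (Fin (n + 1)) ℂ}

theorem eq_zero_of_commute_of_col_zero (hA : (krylov A).det ≠ 0)
    {X : Matrix (Fin (n + 1)) (Fin (n + 1)) ℂ} (hcomm : X * A - A * X = 0)
    (hX : ∀ j, X j 0 = 0) : X = 0 := by
  have hc : Commute X A := sub_eq_zero.mp hcomm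
  have hmul : X * krylov A = 0 := by
    ext i k
    change (X * A ^ (k : ℕ)) i 0 = 0
    rw [(hc.pow_right k).eq, Matrix.mul_apply]
    simp [hX]
  rw [← Matrix.mul_nonsing_inv_cancel_right _ X (isUnit_iff_ne_zero.mpr hA), hmul, Matrix.zero_mul]

/-- The matrices whose row and column `0` vanish. -/
def zeroBorder (n : ℕ) : Submodule ℂ (Matrix (Fin (n + 1)) (Fin (n + 1)) ℂ) :=
  supportedOn ({0}ᶜ ×ˢ {0}ᶜ)

theorem mem_zeroBorder {X : Matrix (Fin (n + 1)) (Fin (n + 1)) ℂ} :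
    X ∈ zeroBorder n ↔ (∀ j, X 0 j = 0) ∧ ∀ j, X j 0 = 0 := by
  refine ⟨fun h => ⟨fun j => h 0 j (by simp), fun j => h j 0 (by simp)⟩, ?_⟩
  rintro ⟨hr, hc⟩ i j hij
  by_cases hi : i = 0
  · rw [hi, hr]
  · have hj : j = 0 := by simpa [hi] using hij
    rw [hj, hc]

theorem finrank_zeroBorder (n : ℕ) : Module.finrank ℂ (zeroBorder n) = n * n := by
  rw [zeroBorder, finrank_supportedOn, Set.ncard_prod, Set.ncard_compl]
  simp

theorem commutatorRight_injOn_zeroBorder (hA : (krylov A).det ≠ 0)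
    {p : Submodule ℂ (Matrix (Fin (n + 1)) (Fin (n + 1)) ℂ)} (hp : p ≤ zeroBorder n) :
    Function.Injective ((commutatorRight A).domRestrict p) := by
  rw [← LinearMap.ker_eq_bot, LinearMap.ker_eq_bot']
  rintro ⟨X, hX⟩ h
  exact Subtype.ext (eq_zero_of_commute_of_col_zero hA h (mem_zeroBorder.mp (hp hX)).2)

theorem ker_fderiv_dcp (hA : (krylov A).det ≠ 0) :
    LinearMap.ker (fderiv ℂ (dcp (n + 1)) A).toLinearMap =
      (zeroBorder n).map (commutatorRight A) := by
  apply Submodule.eq_of_le_of_finrank_le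
  · intro M hM
    obtain ⟨X, hr, hc, hXM⟩ := exists_commutator_of_fderiv_dcp_eq_zero hA hM
    exact ⟨X, mem_zeroBorder.mpr ⟨hr, hc⟩, hXM⟩
  · have h1 : Module.finrank ℂ ((zeroBorder n).map (commutatorRight A)) = n * n := by
      rw [← LinearMap.range_domRestrict, LinearMap.finrank_range_of_inj
        (commutatorRight_injOn_zeroBorder hA le_rfl), finrank_zeroBorder]
    have h2 := (fderiv ℂ (dcp (n + 1)) A).toLinearMap.finrank_range_add_finrank_ker
    have h3 := (LinearMap.range (fderiv ℂ (dcp (n + 1)) A).toLinearMap).finrank_le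
    simp only [Module.finrank_matrix, Module.finrank_prod, Module.finrank_fintype_fun_eq_card,
      Fintype.card_fin, Module.finrank_self] at h2 h3
    rw [h1]
    have : (n + 1) * (n + 1) = n * n + (2 * n + 1) := by ring
    omega

/-- The matrices supported off row `0`, column `0` and the diagonal. -/
def hollow (n : ℕ) : Submodule ℂ (Matrix (Fin (n + 1)) (Fin (n + 1)) ℂ) :=
  zeroBorder n ⊓ supportedOn (Set.diagonal _)ᶜ

theorem mem_hollow {X : Matrix (Fin (n + 1)) (Fin (n + 1)) ℂ} :
    X ∈ hollow n ↔ (∀ j, X 0 j = 0) ∧ (∀ j, X j 0 = 0) ∧ ∀ j, X j j = 0 := by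
  rw [hollow, Submodule.mem_inf, mem_zeroBorder, and_assoc]
  refine and_congr_right fun _ => and_congr_right fun _ => ⟨fun h j => h j j (by simp), ?_⟩
  intro h i j hij
  obtain rfl : i = j := by simpa using hij
  exact h i

theorem finrank_zeroBorder_inf_comap (E : Fin (n + 1) → Fin (n + 1) → Prop) (hA : A ∈ Theta E) :
    Module.finrank ℂ ↥(zeroBorder n ⊓ (ThetaSub E).comap (commutatorRight A)) =
      n + Module.finrank ℂ ↥(hollow n ⊓ (ThetaSub E).comap (commutatorRight A)) := by
  set p := zeroBorder n ⊓ (ThetaSub E).comap (commutatorRight A) with hp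
  set q := hollow n ⊓ (ThetaSub E).comap (commutatorRight A) with hq
  have hqp : q ≤ p := inf_le_inf_right _ inf_le_left
  let D : p →ₗ[ℂ] (Fin n → ℂ) :=
    { toFun := fun X i => X.1 i.succ i.succ
      map_add' := fun _ _ => rfl
      map_smul' := fun _ _ => rfl }
  have hker : LinearMap.ker D = q.comap p.subtype := by
    ext ⟨X, hX⟩
    have hX' := mem_zeroBorder.mp hX.1
    simp only [LinearMap.mem_ker, Submodule.mem_comap, Submodule.subtype_apply, hq,
      Submodule.mem_inf, mem_hollow, hX'.1, hX'.2, implies_true, true_and]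
    refine ⟨fun h => ⟨fun j => ?_, hX.2⟩, fun h => funext fun i => h.1 i.succ⟩
    refine Fin.cases (hX'.1 0) (fun i => congrFun h i) j
  have hsurj : Function.Surjective D := by
    intro d
    refine ⟨⟨Matrix.diagonal (Fin.cons 0 d), ?_, ?_⟩, ?_⟩
    · refine mem_zeroBorder.mpr ⟨fun j => ?_, fun j => ?_⟩
      · by_cases h : 0 = j
        · simp [← h]
        · simp [h]
      · by_cases h : j = 0
        · simp [h]
        · simp [h]
    · intro i j hij hE
      simp [commutatorRight, hA i j hij hE]
    · ext i
      change Matrix.diagonal (Fin.cons 0 d : Fin (n + 1) → ℂ) i.succ i.succ = d i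
      simp
  have h := D.finrank_range_add_finrank_ker
  rw [LinearMap.range_eq_top.mpr hsurj, finrank_top, Module.finrank_fintype_fun_eq_card,
    Fintype.card_fin, hker, (Submodule.comapSubtypeEquivOfLe hqp).finrank_eq] at h
  exact h.symm

theorem diffRank_add_finrank (E : Fin (n + 1) → Fin (n + 1) → Prop) (hirr : ∀ v, ¬ E v v)
    (hA : A ∈ Theta E) (hK : (krylov A).det ≠ 0) :
    diffRank (n + 1) E A +
        Module.finrank ℂ ↥(hollow n ⊓ (ThetaSub E).comap (commutatorRight A)) =
      Nat.card {p : Fin (n + 1) × Fin (n + 1) // E p.1 p.2} + 1 := by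
  set f := (fderiv ℂ (dcp (n + 1)) A).toLinearMap ∘ₗ (ThetaSub E).subtype with hf
  have hker : (LinearMap.ker f).map (ThetaSub E).subtype =
      (zeroBorder n ⊓ (ThetaSub E).comap (commutatorRight A)).map (commutatorRight A) := by
    rw [hf, LinearMap.ker_comp, Submodule.map_comap_subtype, ker_fderiv_dcp hK]
    apply SetLike.coe_injective
    simp only [Submodule.coe_inf, Submodule.map_coe, Submodule.comap_coe,
      Set.image_inter_preimage, Set.inter_comm]
  have h1 := LinearMap.finrank_range_of_inj
    (commutatorRight_injOn_zeroBorder hK (p := zeroBorder n ⊓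
      (ThetaSub E).comap (commutatorRight A)) inf_le_left)
  rw [LinearMap.range_domRestrict, ← hker, Submodule.finrank_map_subtype_eq,
    finrank_zeroBorder_inf_comap E hA] at h1
  have h2 := f.finrank_range_add_finrank_ker
  rw [h1, finrank_ThetaSub E hirr] at h2
  change Module.finrank ℂ (LinearMap.range f) + _ = _
  omega

end DimensionCount

section Genericity

open Filter Topology

variable {n : ℕ}

theorem exists_mem_Theta_det_krylov_ne_zero_of_eventually
    (E : Fin (n + 1) → Fin (n + 1) → Prop) (hsc : ∀ v, Relation.ReflTransGen E 0 v)
    {A₀ : Matrix (Fin (n + 1)) (Fin (n + 1)) ℂ} (hA₀ : A₀ ∈ Theta E)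
    {P : Matrix (Fin (n + 1)) (Fin (n + 1)) ℂ → Prop} (hP : ∀ᶠ A in 𝓝 A₀, P A) :
    ∃ A ∈ Theta E, (krylov A).det ≠ 0 ∧ P A := by
  obtain ⟨B, hB, hBdet⟩ := exists_mem_Theta_det_krylov_ne_zero E hsc
  let γ : ℂ → Matrix (Fin (n + 1)) (Fin (n + 1)) ℂ := fun t => A₀ + t • (B - A₀)
  let p : ℂ[X] := (krylov (A₀.map C + (X : ℂ[X]) • (B - A₀).map C)).det
  have hp : ∀ t, p.eval t = (krylov (γ t)).det := by
    intro t
    rw [← Polynomial.coe_evalRingHom, RingHom.map_det, RingHom.mapMatrix_apply, ← krylov_map]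
    congr 2
    ext i j
    simp [γ]
  have hp0 : p ≠ 0 := by
    intro h
    apply hBdet
    have := hp 1
    simpa [h, γ] using this.symm
  have hγ : Tendsto γ (𝓝 0) (𝓝 A₀) := by
    have : Continuous γ := by fun_prop
    simpa [γ] using this.tendsto 0
  have hfin : ∀ᶠ t in 𝓝[≠] (0 : ℂ), p.eval t ≠ 0 := by
    have hclosed : IsClosed ((p.roots.toFinset : Set ℂ) \ {0}) :=
      (p.roots.toFinset.finite_toSet.subset Set.sdiff_subset).isClosed
    filter_upwards [nhdsWithin_le_nhds (hclosed.isOpen_compl.mem_nhds (by simp)),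
      self_mem_nhdsWithin] with t ht ht0 hroot
    exact ht ⟨by simpa [hp0] using hroot, ht0⟩
  obtain ⟨t, ht, htP⟩ := (hfin.and (nhdsWithin_le_nhds (hγ.eventually hP))).exists
  refine ⟨γ t, ?_, hp t ▸ ht, htP⟩
  exact (ThetaSub E).add_mem hA₀ ((ThetaSub E).smul_mem t ((ThetaSub E).sub_mem hB hA₀))

theorem eventually_diffRank_le (E : Fin n → Fin n → Prop) (A₀ : Matrix (Fin n) (Fin n) ℂ) :
    ∀ᶠ A in 𝓝 A₀, diffRank n E A₀ ≤ diffRank n E A := by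
  have hF : Continuous fun A => (fderiv ℂ (dcp n) A).comp (ThetaSub E).subtypeL :=
    ((contDiff_dcp n).continuous_fderiv one_ne_zero).clm_comp_const _
  have hrank : ∀ A, ((diffRank n E A : ℕ) : Cardinal) =
      ((fderiv ℂ (dcp n) A).toLinearMap ∘ₗ (ThetaSub E).subtype).rank := fun A =>
    Module.finrank_eq_rank ℂ _
  have hopen := (isOpen_setOfPred_nat_le_rank (𝕜 := ℂ) (E := ThetaSub E)
    (F := (Fin n → ℂ) × (Fin (n - 1) → ℂ)) (diffRank n E A₀)).preimage hF
  filter_upwards [hopen.mem_nhds (hrank A₀).le] with A hA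
  have h : ((diffRank n E A₀ : ℕ) : Cardinal) ≤
      ((fderiv ℂ (dcp n) A).toLinearMap ∘ₗ (ThetaSub E).subtype).rank := hA
  rw [← hrank A] at h
  exact_mod_cast h

theorem eventually_injective_of_finiteDimensional {M F G : Type*}
    [AddCommGroup M] [Module ℂ M] [TopologicalSpace M] [IsTopologicalAddGroup M]
    [ContinuousSMul ℂ M] [T2Space M] [FiniteDimensional ℂ M]
    [NormedAddCommGroup F] [NormedSpace ℂ F] [FiniteDimensional ℂ F]
    [NormedAddCommGroup G] [NormedSpace ℂ G] [FiniteDimensional ℂ G]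
    (L : M →ₗ[ℂ] F →ₗ[ℂ] G) {x₀ : M} (hx₀ : Function.Injective (L x₀)) :
    ∀ᶠ x in 𝓝 x₀, Function.Injective (L x) := by
  have hcont : Continuous (LinearMap.toContinuousLinearMap.toLinearMap ∘ₗ L) :=
    LinearMap.continuous_of_finiteDimensional _
  exact (ContinuousLinearMap.isOpen_injective.preimage hcont).mem_nhds hx₀

theorem eventually_hollow_inf_comap_eq_bot (E : Fin (n + 1) → Fin (n + 1) → Prop)
    {A₀ : Matrix (Fin (n + 1)) (Fin (n + 1)) ℂ}
    (hA₀ : hollow n ⊓ (ThetaSub E).comap (commutatorRight A₀) = ⊥) :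
    ∀ᶠ A in 𝓝 A₀, hollow n ⊓ (ThetaSub E).comap (commutatorRight A) = ⊥ := by
  let L : Matrix (Fin (n + 1)) (Fin (n + 1)) ℂ →ₗ[ℂ] hollow n →ₗ[ℂ]
      ({p : Fin (n + 1) × Fin (n + 1) // p.1 ≠ p.2 ∧ ¬ E p.2 p.1} → ℂ) :=
    LinearMap.mk₂ ℂ (fun A X p => (X.1 * A - A * X.1) p.1.1 p.1.2)
      (fun A B X => by
        ext p
        simp only [Matrix.mul_add, Matrix.add_mul, Matrix.sub_apply, Matrix.add_apply,
          Pi.add_apply]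
        ring)
      (fun c A X => by
        ext p
        simp [mul_sub])
      (fun A X Y => by
        ext p
        simp only [Submodule.coe_add, Matrix.mul_add, Matrix.add_mul, Matrix.sub_apply,
          Matrix.add_apply, Pi.add_apply]
        ring)
      (fun c A X => by
        ext p
        simp [mul_sub])
  have hL : ∀ A, Function.Injective (L A) ↔
      hollow n ⊓ (ThetaSub E).comap (commutatorRight A) = ⊥ := by
    intro A
    rw [← LinearMap.ker_eq_bot, LinearMap.ker_eq_bot', Submodule.eq_bot_iff]
    constructor
    · rintro h X ⟨hX, hXA⟩
      exact congrArg Subtype.val (h ⟨X, hX⟩ (funext fun p => hXA p.1.1 p.1.2 p.2.1 p.2.2))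
    · rintro h ⟨X, hX⟩ hXA
      exact Subtype.ext (h X ⟨hX, fun i j hij hE => congrFun hXA ⟨(i, j), hij, hE⟩⟩)
  filter_upwards [eventually_injective_of_finiteDimensional L ((hL A₀).mpr hA₀)] with A hA
  exact (hL A).mp hA

end Genericity

/-- For a strongly connected directed simple graph `G` on
`Fin n` (`n ≥ 2`) with `m` edges and distinguished vertex `0`, there exists
`A ∈ Θ_G` at which the differential of the double characteristic polynomial
map restricted to `Θ_G` has rank `m + 1` if and only if there exists
`A ∈ Θ_G` such that the only matrix `X` supported off the `0`-th row, the
`0`-th column and the diagonal with `[X, A] ∈ Θ_G` is `X = 0`. -/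
theorem dimension_criterion_iff_no_nontrivial_X (n : ℕ) (hn : 2 ≤ n)
    (E : Fin n → Fin n → Prop) (hirr : ∀ v, ¬ E v v)
    (hsc : ∀ u v : Fin n, Relation.ReflTransGen E u v)
    (m : ℕ) (hm : m = Nat.card {p : Fin n × Fin n // E p.1 p.2}) :
    (∃ A ∈ Theta E, diffRank n E A = m + 1) ↔
      (∃ A ∈ Theta E, ∀ X : Matrix (Fin n) (Fin n) ℂ,
        (∀ j, X ⟨0, by omega⟩ j = 0) → (∀ j, X j ⟨0, by omega⟩ = 0) →
        (∀ j, X j j = 0) → X * A - A * X ∈ Theta E → X = 0) := by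
  obtain ⟨n, rfl⟩ : ∃ k, n = k + 1 := ⟨n - 1, by omega⟩
  subst hm
  have hbot : ∀ A : Matrix (Fin (n + 1)) (Fin (n + 1)) ℂ,
      hollow n ⊓ (ThetaSub E).comap (commutatorRight A) = ⊥ ↔
        ∀ X : Matrix (Fin (n + 1)) (Fin (n + 1)) ℂ, (∀ j, X 0 j = 0) → (∀ j, X j 0 = 0) →
          (∀ j, X j j = 0) → X * A - A * X ∈ Theta E → X = 0 := by
    intro A
    rw [Submodule.eq_bot_iff]
    exact ⟨fun h X hr hc hd hX => h X ⟨mem_hollow.mpr ⟨hr, hc, hd⟩, hX⟩,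
      fun h X ⟨hX, hXA⟩ => h X (mem_hollow.mp hX).1 (mem_hollow.mp hX).2.1
        (mem_hollow.mp hX).2.2 hXA⟩
  constructor
  · rintro ⟨A₀, hA₀, hrank⟩
    obtain ⟨A, hA, hK, hle⟩ := exists_mem_Theta_det_krylov_ne_zero_of_eventually E (hsc 0) hA₀
      (eventually_diffRank_le E A₀)
    refine ⟨A, hA, (hbot A).mp (Submodule.finrank_eq_zero.mp ?_)⟩
    have := diffRank_add_finrank E hirr hA hK
    omega
  · rintro ⟨A₀, hA₀, hX⟩
    obtain ⟨A, hA, hK, h⟩ := exists_mem_Theta_det_krylov_ne_zero_of_eventually E (hsc 0) hA₀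
      (eventually_hollow_inf_comap_eq_bot E ((hbot A₀).mpr hX))
    refine ⟨A, hA, ?_⟩
    rw [← diffRank_add_finrank E hirr hA hK, h, finrank_bot, add_zero]
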